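/- arXiv:1709.02806 — 3 statements merged into one kernel-verified Lean document; each statement's English description precedes it below -/
import Mathlib

section
/- There exist a signed group (G, ε), a full signed group orthogonal design SOD(2^5; 1, 1, 1, 9, 9, 11) over (G, ε), and a remrep of (G, ε) of degree 2^7. -/
/-- A signed group: a group `G` together with a distinguished central element `ε`
of order two. -/
structure SignedGroup where
  /-- the underlying group -/
  G : Type
  /-- the group structure -/
  grp : Group G
  /-- the distinguished central element -/
  ε : G
  central : ∀ g : G, ε * g = g * ε
  sq : ε * ε = 1
  ne_one : ε ≠ 1

attribute [instance] SignedGroup.grp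

namespace SignedGroup

/-- The number of columns `j` in row `a` whose entry is the variable `x i`
(with some signed-group coefficient). -/
noncomputable def rowCount (S : SignedGroup) {n k : ℕ} (X : Fin n → Fin n → Option (S.G × Fin k))
    (a : Fin n) (i : Fin k) : ℕ :=
  Nat.card {j : Fin n // ∃ g : S.G, X a j = some (g, i)}

/-- `pairCount S X a b i i' g` is the number of columns `j` for which
`X a j = some (s, i)` and `X b j = some (s', i')` with `s * s'⁻¹ = g`. -/
noncomputable def pairCount (S : SignedGroup) {n k : ℕ} (X : Fin n → Fin n → Option (S.G × Fin k))
    (a b : Fin n) (i i' : Fin k) (g : S.G) : ℕ :=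
  Nat.card {j : Fin n //
    ∃ s s' : S.G, X a j = some (s, i) ∧ X b j = some (s', i') ∧ s * s'⁻¹ = g}

/-- `X` is a signed group orthogonal design `SOD(n; u 0, …, u (k-1))` over `S`. -/
def IsSOD (S : SignedGroup) {n k : ℕ} (u : Fin k → ℕ)
    (X : Fin n → Fin n → Option (S.G × Fin k)) : Prop :=
  (∀ (a : Fin n) (i : Fin k), S.rowCount X a i = u i) ∧
  (∀ a b : Fin n, a ≠ b → ∀ (i i' : Fin k) (g : S.G),
    S.pairCount X a b i i' g + S.pairCount X a b i' i g =
      S.pairCount X a b i i' (S.ε * g) + S.pairCount X a b i' i (S.ε * g))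

/-- An SOD is full if it has no zero entries. -/
def IsFull (S : SignedGroup) {n k : ℕ} (X : Fin n → Fin n → Option (S.G × Fin k)) : Prop :=
  ∀ a b : Fin n, X a b ≠ none

end SignedGroup

/-- A signed permutation matrix: every row and every column has exactly one
nonzero entry, and every entry is `0`, `1` or `-1`. -/
def IsSignedPermMatrix {m : ℕ} (M : Matrix (Fin m) (Fin m) ℝ) : Prop :=
  (∀ a : Fin m, ∃! b : Fin m, M a b ≠ 0) ∧
  (∀ b : Fin m, ∃! a : Fin m, M a b ≠ 0) ∧
  (∀ a b : Fin m, M a b = 0 ∨ M a b = 1 ∨ M a b = -1)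

/-- A remrep (real monomial representation) of degree `m` of a signed group `S`. -/
def IsRemrep (S : SignedGroup) (m : ℕ) (φ : S.G → Matrix (Fin m) (Fin m) ℝ) : Prop :=
  φ 1 = 1 ∧ (∀ g h : S.G, φ (g * h) = φ g * φ h) ∧ φ S.ε = -1 ∧
  ∀ g : S.G, IsSignedPermMatrix (φ g)

/-! ### The real Pauli group -/

/-- The real Pauli (Heisenberg) group on `n` qubits: the element `⟨s, a, b⟩` stands for
`(-1) ^ s * X ^ a * Z ^ b`. -/
@[ext]
structure Pauli (n : ℕ) where
  /-- the exponent of the sign -/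
  s : ZMod 2
  /-- the translation part -/
  a : Fin n → ZMod 2
  /-- the character part -/
  b : Fin n → ZMod 2

namespace Pauli

variable {n : ℕ}

instance : Mul (Pauli n) := ⟨fun g h => ⟨g.s + h.s + g.b ⬝ᵥ h.a, g.a + h.a, g.b + h.b⟩⟩

instance : One (Pauli n) := ⟨⟨0, 0, 0⟩⟩

instance : Inv (Pauli n) := ⟨fun g => ⟨-g.s + g.b ⬝ᵥ g.a, -g.a, -g.b⟩⟩

@[simp] theorem mul_s (g h : Pauli n) : (g * h).s = g.s + h.s + g.b ⬝ᵥ h.a := rfl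
@[simp] theorem mul_a (g h : Pauli n) : (g * h).a = g.a + h.a := rfl
@[simp] theorem mul_b (g h : Pauli n) : (g * h).b = g.b + h.b := rfl
@[simp] theorem one_s : (1 : Pauli n).s = 0 := rfl
@[simp] theorem one_a : (1 : Pauli n).a = 0 := rfl
@[simp] theorem one_b : (1 : Pauli n).b = 0 := rfl
@[simp] theorem inv_s (g : Pauli n) : g⁻¹.s = -g.s + g.b ⬝ᵥ g.a := rfl
@[simp] theorem inv_a (g : Pauli n) : g⁻¹.a = -g.a := rfl
@[simp] theorem inv_b (g : Pauli n) : g⁻¹.b = -g.b := rfl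

instance : Group (Pauli n) :=
  Group.ofLeftAxioms
    (fun g h k => by
      ext1
      · simp only [mul_s, mul_a, mul_b, add_dotProduct, dotProduct_add]
        ring
      · simp [add_assoc]
      · simp [add_assoc])
    (fun g => by ext1 <;> simp)
    (fun g => by ext1 <;> simp [add_right_comm, CharTwo.add_self_eq_zero])

/-- The central element `(-1) ^ s`. -/
def sign (s : ZMod 2) : Pauli n := ⟨s, 0, 0⟩

theorem sign_mul_comm (s : ZMod 2) (g : Pauli n) : sign s * g = g * sign s := by
  ext1 <;> simp [sign, add_comm]

theorem sign_add (s t : ZMod 2) : (sign (s + t) : Pauli n) = sign s * sign t := by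
  ext1 <;> simp [sign]

theorem sign_inv (s : ZMod 2) : (sign s : Pauli n)⁻¹ = sign s := by
  ext1 <;> simp [sign]

theorem sign_mul_mul_inv (s t : ZMod 2) (g h : Pauli n) :
    sign s * g * (sign t * h)⁻¹ = sign (s + t) * (g * h⁻¹) := by
  rw [mul_inv_rev, sign_inv, sign_add, ← sign_mul_comm, mul_assoc, mul_assoc,
    ← mul_assoc g, ← sign_mul_comm, mul_assoc]

/-- The Pauli group as a signed group. -/
def signedGroup (n : ℕ) : SignedGroup where
  G := Pauli n
  grp := inferInstance
  ε := sign 1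
  central := sign_mul_comm 1
  sq := by rw [← sign_add]; rfl
  ne_one h := one_ne_zero (congrArg Pauli.s h)

/-! ### The monomial representation -/

/-- The real number `(-1) ^ s`. -/
def realSign (s : ZMod 2) : ℝ := if s = 0 then 1 else -1

theorem realSign_add (s t : ZMod 2) : realSign (s + t) = realSign s * realSign t := by
  have key : ∀ r : ZMod 2, r = 0 ∨ r = 1 := by decide
  rcases key s with rfl | rfl <;> rcases key t with rfl | rfl <;>
    simp [realSign, CharTwo.add_self_eq_zero]

theorem realSign_ne_zero (s : ZMod 2) : realSign s ≠ 0 := by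
  unfold realSign
  split_ifs <;> norm_num

/-- The action of the Pauli group on real functions on `𝔽₂ⁿ`. -/
def toMatrix (g : Pauli n) : Matrix (Fin n → ZMod 2) (Fin n → ZMod 2) ℝ :=
  fun u v => if u = g.a + v then realSign (g.s + g.b ⬝ᵥ v) else 0

theorem toMatrix_one : toMatrix (1 : Pauli n) = 1 := by
  ext u v
  simp [toMatrix, Matrix.one_apply, realSign]

theorem toMatrix_sign_one : toMatrix (sign 1 : Pauli n) = -1 := by
  ext u v
  by_cases h : u = v <;> simp [toMatrix, sign, realSign, h]

theorem toMatrix_mul (g h : Pauli n) : toMatrix (g * h) = toMatrix g * toMatrix h := by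
  ext u v
  rw [Matrix.mul_apply, Finset.sum_eq_single (h.a + v)]
  · simp only [toMatrix, mul_s, mul_a, mul_b, add_assoc]
    by_cases huv : u = g.a + (h.a + v)
    · simp only [huv, if_true, ← realSign_add, add_dotProduct, dotProduct_add]
      congr 1
      ring
    · simp [huv]
  · intro w _ hw
    simp [toMatrix, hw]
  · simp

theorem toMatrix_ne_zero_iff (g : Pauli n) (u v : Fin n → ZMod 2) :
    toMatrix g u v ≠ 0 ↔ u = g.a + v := by
  simp [toMatrix, realSign_ne_zero]

theorem isSignedPermMatrix_toMatrix {m : ℕ} (e : Fin m ≃ (Fin n → ZMod 2)) (g : Pauli n) :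
    IsSignedPermMatrix ((toMatrix g).submatrix e e) := by
  refine ⟨fun u => ⟨e.symm (-g.a + e u), ?_, fun v hv => ?_⟩,
    fun v => ⟨e.symm (g.a + e v), ?_, fun u hu => ?_⟩, fun u v => ?_⟩
  · simp [toMatrix_ne_zero_iff]
  · replace hv := (toMatrix_ne_zero_iff g _ _).1 hv
    simp [hv]
  · simp [toMatrix_ne_zero_iff]
  · replace hu := (toMatrix_ne_zero_iff g _ _).1 hu
    simp [← hu]
  · simp only [Matrix.submatrix_apply, toMatrix, realSign]
    split_ifs <;> simp

theorem isRemrep_toMatrix {m : ℕ} (e : Fin m ≃ (Fin n → ZMod 2)) :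
    IsRemrep (signedGroup n) m (fun g => (toMatrix g).submatrix e e) := by
  refine ⟨?_, fun g h => ?_, ?_, isSignedPermMatrix_toMatrix e⟩
  · exact (congrArg (fun M => M.submatrix e e) toMatrix_one).trans (Matrix.submatrix_one_equiv e)
  · exact (congrArg (fun M => M.submatrix e e) (toMatrix_mul g h)).trans
      (Matrix.submatrix_mul_equiv _ _ e e e).symm
  · refine (congrArg (fun M => M.submatrix e e) toMatrix_sign_one).trans ?_
    rw [Matrix.submatrix_neg, Pi.neg_apply, Pi.neg_apply, Matrix.submatrix_one_equiv]

end Pauli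

/-! ### Orthogonality from a sign-reversing pairing of columns -/

namespace SignedGroup

variable (S : SignedGroup) {n k : ℕ}

theorem rowCount_some (c : Fin n → Fin n → S.G) (v : Fin n → Fin n → Fin k)
    (a : Fin n) (i : Fin k) :
    S.rowCount (fun a j => some (c a j, v a j)) a i =
      (Finset.univ.filter fun j => v a j = i).card := by
  simp [rowCount, Fintype.card_subtype]

open Classical in
theorem pairCount_some (c : Fin n → Fin n → S.G) (v : Fin n → Fin n → Fin k)
    (a b : Fin n) (i i' : Fin k) (g : S.G) :
    S.pairCount (fun a j => some (c a j, v a j)) a b i i' g =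
      ∑ j, if v a j = i ∧ v b j = i' ∧ c a j * (c b j)⁻¹ = g then 1 else 0 := by
  rw [pairCount, Nat.card_eq_fintype_card, Fintype.card_subtype, Finset.card_filter]
  refine Finset.sum_congr rfl fun j _ => if_congr ?_ rfl rfl
  simp only [Option.some.injEq, Prod.mk.injEq]
  constructor
  · rintro ⟨s, s', ⟨rfl, hi⟩, ⟨rfl, hi'⟩, hg⟩
    exact ⟨hi, hi', hg⟩
  · rintro ⟨hi, hi', hg⟩
    exact ⟨_, _, ⟨rfl, hi⟩, ⟨rfl, hi'⟩, hg⟩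

/-- Two rows are orthogonal if their columns can be paired so that paired columns carry the same
unordered pair of variables and opposite quotients of coefficients. -/
theorem pairCount_add_eq_of_pairing (c : Fin n → Fin n → S.G) (v : Fin n → Fin n → Fin k)
    (a b : Fin n) (p : Fin n → Fin n) (hp : Function.Involutive p)
    (hv : ∀ j, (v a (p j) = v a j ∧ v b (p j) = v b j) ∨ (v a (p j) = v b j ∧ v b (p j) = v a j))
    (hc : ∀ j, c a (p j) * (c b (p j))⁻¹ = S.ε * (c a j * (c b j)⁻¹))
    (i i' : Fin k) (g : S.G) :
    S.pairCount (fun a j => some (c a j, v a j)) a b i i' g +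
        S.pairCount (fun a j => some (c a j, v a j)) a b i' i g =
      S.pairCount (fun a j => some (c a j, v a j)) a b i i' (S.ε * g) +
        S.pairCount (fun a j => some (c a j, v a j)) a b i' i (S.ε * g) := by
  classical
  simp only [pairCount_some, ← Finset.sum_add_distrib]
  refine Fintype.sum_equiv hp.toPerm _ _ fun j => ?_
  simp only [Function.Involutive.coe_toPerm, hc, mul_right_inj]
  rcases hv j with ⟨h, h'⟩ | ⟨h, h'⟩
  · simp only [h, h']
  · simp only [h, h']
    rw [add_comm]
    congr 1 <;> exact if_congr (by tauto) rfl rfl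

end SignedGroup

/-! ### The design

Rows and columns are bit vectors of length `5`: the two high bits number a block, the three low
bits form a vector of `𝔽₂³`. The diagonal blocks carry eight variables, each once per row; the
three kinds of off-diagonal blocks carry one variable each, with the signs of the Sylvester matrix
of order `8`. -/

namespace Design

/-- The parity of the three low bits. -/
def parity (x : BitVec 5) : Bool := (x.getLsbD 0 ^^ x.getLsbD 1) ^^ x.getLsbD 2

theorem parity_xor (x y : BitVec 5) : parity (x ^^^ y) = (parity x ^^ parity y) := by
  have key : ∀ p p' q q' r r' : Bool,
      ((p ^^ p') ^^ (q ^^ q') ^^ (r ^^ r')) = ((p ^^ q ^^ r) ^^ (p' ^^ q' ^^ r')) := by decide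
  simpa only [parity, BitVec.getLsbD_xor] using key _ _ _ _ _ _

/-- Whether the two high bits vanish. -/
def isLow (x : BitVec 5) : Bool := decide (x.toNat < 8)

/-- The variable (out of eleven) in the entries whose row and column differ by `t`. -/
def fineVar (t : BitVec 5) : Fin 11 :=
  Fin.ofNat 11 (if isLow t then t.toNat else 7 + t.toNat / 8)

/-- Whether the entry in row `a` and column `j` is negative. -/
def negative (a j : BitVec 5) : Bool :=
  parity (a &&& j) ^^ (isLow (a ^^^ j) && parity j)

/-- Identification of the eleven variables to six. -/
def coarse : Fin 11 → Fin 6 := ![0, 1, 2, 3, 4, 5, 5, 5, 3, 4, 5]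

/-- The Pauli coefficients of the eleven variables. -/
def coeff : Fin 11 → Pauli 7 :=
  ![⟨0, ![1, 0, 0, 0, 1, 0, 1], ![0, 0, 0, 0, 0, 0, 1]⟩,
    ⟨0, ![0, 0, 1, 0, 1, 0, 1], ![0, 0, 0, 0, 0, 0, 1]⟩,
    ⟨0, ![0, 0, 0, 0, 1, 0, 1], ![0, 0, 1, 0, 0, 0, 1]⟩,
    ⟨0, ![0, 0, 0, 0, 1, 0, 1], ![1, 0, 0, 0, 0, 0, 1]⟩,
    ⟨0, ![0, 0, 1, 1, 1, 0, 0], ![0, 0, 1, 0, 0, 0, 0]⟩,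
    ⟨0, ![1, 1, 0, 0, 1, 0, 0], ![1, 0, 0, 0, 0, 0, 0]⟩,
    ⟨0, ![1, 0, 0, 0, 1, 0, 0], ![1, 1, 0, 0, 0, 0, 0]⟩,
    ⟨0, ![0, 0, 1, 0, 1, 0, 0], ![0, 0, 1, 1, 0, 0, 0]⟩,
    1,
    ⟨0, ![0, 0, 0, 0, 1, 1, 0], ![0, 0, 0, 0, 1, 0, 0]⟩,
    ⟨0, ![0, 0, 0, 0, 1, 0, 0], ![0, 0, 0, 0, 1, 1, 0]⟩]

/-- Whether inverting the quotient of the coefficients of two variables changes its sign. -/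
def skew (v w : Fin 11) : Bool :=
  decide (v ≠ w) && !(decide (v.val < 8) && decide (w.val < 8) &&
    (parity (BitVec.ofNat 5 v.val) ^^ parity (BitVec.ofNat 5 w.val)))

theorem coeff_mul_inv (v w : Fin 11) :
    coeff w * (coeff v)⁻¹ =
      Pauli.sign (if skew v w then 1 else 0) * (coeff v * (coeff w)⁻¹) := by
  rw [Pauli.ext_iff, funext_iff, funext_iff]
  revert v w
  decide +kernel

/-- A bit among the three low ones that is set in `x`, if there is any. -/
def lowBit (x : BitVec 5) : BitVec 5 :=
  if x.getLsbD 0 then 1 else if x.getLsbD 1 then 2 else 4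

/-- The difference of paired columns in the scalar product of two rows that differ from the
column by `t` and `u`. -/
def shift (t u : BitVec 5) : BitVec 5 :=
  if isLow t || isLow u then t ^^^ u
  else if isLow (t ^^^ u) then lowBit (t ^^^ u)
  else (t ^^^ u) &&& 24

/-- The change of sign of the product of the entries of rows `a` and `b` when the column `j` is
replaced by `j ^^^ f`, where `t = a ^^^ j`, `u = b ^^^ j` and `r` is the parity of `j`. -/
def signChange (t u f : BitVec 5) (r : Bool) : Bool :=
  parity ((t ^^^ u) &&& f) ^^ ((isLow t ^^ isLow u) && r) ^^
    ((isLow (t ^^^ f) ^^ isLow (u ^^^ f)) && (r ^^ parity f))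

theorem negative_xor (a b j f : BitVec 5) :
    (negative a (j ^^^ f) ^^ negative b (j ^^^ f)) =
      ((negative a j ^^ negative b j) ^^ signChange (a ^^^ j) (b ^^^ j) f (parity j)) := by
  have hab : (a ^^^ j) ^^^ (b ^^^ j) = a ^^^ b := by
    rw [BitVec.xor_comm b j, BitVec.xor_assoc, ← BitVec.xor_assoc j j b, BitVec.xor_self,
      BitVec.zero_xor]
  have hand (x y z : BitVec 5) : parity (x &&& (y ^^^ z)) =
      (parity (x &&& y) ^^ parity (x &&& z)) := by
    rw [← parity_xor]
    congr 1
    ext i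
    simp [Bool.and_xor_distrib_left]
  have hand' : parity ((a ^^^ b) &&& f) = (parity (a &&& f) ^^ parity (b &&& f)) := by
    rw [BitVec.and_comm, hand, BitVec.and_comm f a, BitVec.and_comm f b]
  simp only [negative, signChange, hab, hand, hand', parity_xor, ← BitVec.xor_assoc,
    Bool.and_xor_distrib_right]
  have key : ∀ p p' q q' s s' t t' : Bool,
      (p ^^ q ^^ s ^^ (p' ^^ q' ^^ s')) = (p ^^ t ^^ (p' ^^ t') ^^ (q ^^ q' ^^ (t ^^ t') ^^
        (s ^^ s'))) := by decide
  exact key _ _ _ _ _ _ _ _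

theorem shift_spec : ∀ t u : Fin (2 ^ 5), t ≠ u →
    let t := BitVec.ofFin t
    let u := BitVec.ofFin u
    let f := shift t u
    shift (t ^^^ f) (u ^^^ f) = f ∧
    ((fineVar (t ^^^ f) = fineVar t ∧ fineVar (u ^^^ f) = fineVar u ∧
        ∀ r, signChange t u f r = true) ∨
      (fineVar (t ^^^ f) = fineVar u ∧ fineVar (u ^^^ f) = fineVar t ∧
        ∀ r, signChange t u f r = !skew (fineVar t) (fineVar u))) := by
  decide +kernel

/-- The column paired with `j` in the scalar product of the rows `a` and `b`. -/
def partner (a b j : BitVec 5) : BitVec 5 := j ^^^ shift (a ^^^ j) (b ^^^ j)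

theorem partner_spec (a b j : BitVec 5) (hab : a ≠ b) :
    partner a b (partner a b j) = j ∧
    ((fineVar (a ^^^ partner a b j) = fineVar (a ^^^ j) ∧
        fineVar (b ^^^ partner a b j) = fineVar (b ^^^ j) ∧
        (negative a (partner a b j) ^^ negative b (partner a b j)) =
          !(negative a j ^^ negative b j)) ∨
      (fineVar (a ^^^ partner a b j) = fineVar (b ^^^ j) ∧
        fineVar (b ^^^ partner a b j) = fineVar (a ^^^ j) ∧
        (negative a (partner a b j) ^^ negative b (partner a b j)) =
          !((negative a j ^^ negative b j) ^^ skew (fineVar (a ^^^ j)) (fineVar (b ^^^ j))))) := by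
  have hne : (a ^^^ j).toFin ≠ (b ^^^ j).toFin := fun h =>
    hab ((BitVec.xor_left_inj j).1 (BitVec.toFin_inj.1 h))
  obtain ⟨hf, h⟩ := shift_spec _ _ hne
  simp only [partner, negative_xor, ← BitVec.xor_assoc]
  refine ⟨?_, h.imp (fun h => ⟨h.1, h.2.1, ?_⟩) (fun h => ⟨h.1, h.2.1, ?_⟩)⟩
  · exact (congrArg _ hf).trans (by rw [BitVec.xor_assoc, BitVec.xor_self, BitVec.xor_zero])
  · exact (congrArg _ (h.2.2 _)).trans (Bool.xor_true _)
  · exact (congrArg _ (h.2.2 _)).trans (Bool.xor_not _ _)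

theorem card_coarse_fineVar : ∀ (a : Fin (2 ^ 5)) (i : Fin 6),
    (Finset.univ.filter fun j : Fin (2 ^ 5) =>
        coarse (fineVar (BitVec.ofFin a ^^^ BitVec.ofFin j)) = i).card =
      (![1, 1, 1, 9, 9, 11] : Fin 6 → ℕ) i := by
  decide +kernel

/-- The coefficient in row `a` and column `j`. -/
def entry (a j : BitVec 5) : Pauli 7 :=
  Pauli.sign (if negative a j then 1 else 0) * coeff (fineVar (a ^^^ j))

theorem entry_partner (a b j : BitVec 5) (hab : a ≠ b) :
    entry a (partner a b j) * (entry b (partner a b j))⁻¹ =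
      Pauli.sign 1 * (entry a j * (entry b j)⁻¹) := by
  unfold entry
  rcases (partner_spec a b j hab).2 with ⟨ha, hb, h⟩ | ⟨ha, hb, h⟩
  · have key : ∀ p q r s : Bool, (p ^^ q) = !(r ^^ s) →
        ((if p then 1 else 0) + (if q then 1 else 0) : ZMod 2) =
          1 + ((if r then 1 else 0) + (if s then 1 else 0)) := by decide
    rw [ha, hb, Pauli.sign_mul_mul_inv, Pauli.sign_mul_mul_inv, key _ _ _ _ h, Pauli.sign_add,
      mul_assoc]
  · have key : ∀ p q r s t : Bool, (p ^^ q) = !((r ^^ s) ^^ t) →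
        ((if p then 1 else 0) + (if q then 1 else 0) + (if t then 1 else 0) : ZMod 2) =
          1 + ((if r then 1 else 0) + (if s then 1 else 0)) := by decide
    rw [ha, hb, Pauli.sign_mul_mul_inv, Pauli.sign_mul_mul_inv, coeff_mul_inv, ← mul_assoc,
      ← Pauli.sign_add, key _ _ _ _ _ h, Pauli.sign_add, mul_assoc]

end Design

/-- There exist a signed group `S`, a full `SOD(2^5; 1, 1, 1, 9, 9, 11)` over
`S`, and a remrep of `S` of degree `2^7`. -/
theorem exists_full_SOD_32_type_1_1_1_9_9_11 :
    ∃ (S : SignedGroup)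
      (X : Fin (2 ^ 5) → Fin (2 ^ 5) → Option (S.G × Fin 6))
      (φ : S.G → Matrix (Fin (2 ^ 7)) (Fin (2 ^ 7)) ℝ),
      S.IsSOD ![1, 1, 1, 9, 9, 11] X ∧ S.IsFull X ∧ IsRemrep S (2 ^ 7) φ := by
  have e : Fin (2 ^ 7) ≃ (Fin 7 → ZMod 2) := Fintype.equivOfCardEq (by simp [ZMod.card])
  let c (a j : Fin (2 ^ 5)) : Pauli 7 := Design.entry (BitVec.ofFin a) (BitVec.ofFin j)
  let v (a j : Fin (2 ^ 5)) : Fin 6 :=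
    Design.coarse (Design.fineVar (BitVec.ofFin a ^^^ BitVec.ofFin j))
  refine ⟨Pauli.signedGroup 7, fun a j => some (c a j, v a j), _,
    ⟨fun a i => ?_, fun a b hab i i' g => ?_⟩, fun a b => Option.some_ne_none _,
    Pauli.isRemrep_toMatrix e⟩
  · exact ((Pauli.signedGroup 7).rowCount_some c v a i).trans (Design.card_coarse_fineVar a i)
  · have hab' : BitVec.ofFin a ≠ BitVec.ofFin b := fun h => hab (congrArg BitVec.toFin h)
    refine (Pauli.signedGroup 7).pairCount_add_eq_of_pairing c v a b
      (fun j => (Design.partner (BitVec.ofFin a) (BitVec.ofFin b) (BitVec.ofFin j)).toFin)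
      (fun j => congrArg BitVec.toFin (Design.partner_spec _ _ _ hab').1) (fun j => ?_)
      (fun j => Design.entry_partner _ _ _ hab') i i' g
    rcases (Design.partner_spec _ _ (BitVec.ofFin j) hab').2 with ⟨ha, hb, -⟩ | ⟨ha, hb, -⟩
    · exact Or.inl ⟨congrArg Design.coarse ha, congrArg Design.coarse hb⟩
    · exact Or.inr ⟨congrArg Design.coarse ha, congrArg Design.coarse hb⟩
end

section
/- There exists an orthogonal design OD(2^12; 2^7 · 1, 2^7 · 1, 2^7 · 1, 2^7 · 9, 2^7 · 9, 2^7 · 11), i.e., an OD of order 4096 and type (128, 128, 128, 1152, 1152, 1408). -/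
open Matrix
/-- An orthogonal design `OD(n; u 0, …, u (k-1))`, encoded by its coefficient
matrices `A i` (of the variable `x i`). -/
def IsOD {n k : ℕ} (u : Fin k → ℕ) (A : Fin k → Matrix (Fin n) (Fin n) ℝ) : Prop :=
  (∀ (i : Fin k) (a b : Fin n), A i a b = 0 ∨ A i a b = 1 ∨ A i a b = -1) ∧
  (∀ i j : Fin k, i ≠ j → ∀ a b : Fin n, A i a b * A j a b = 0) ∧
  (∀ i : Fin k, A i * (A i)ᵀ = (u i : ℝ) • 1) ∧
  (∀ i j : Fin k, i ≠ j → A i * (A j)ᵀ + A j * (A i)ᵀ = 0)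

open scoped Kronecker

namespace IsOD

variable {n k : ℕ} {u : Fin k → ℕ} {A : Fin k → Matrix (Fin n) (Fin n) ℝ}

/-- Kronecker products of the members of an orthogonal design with small `{0, ±1}`-matrices form
an orthogonal design if factors attached to different members are amicable, and factors attached
to the same member are disjoint and anti-amicable. -/
theorem kronecker (h : IsOD u A) {p l : ℕ} (c : Fin l → Fin k) (w : Fin l → ℕ)
    (B : Fin l → Matrix (Fin p) (Fin p) ℝ)
    (entries : ∀ i a b, B i a b = 0 ∨ B i a b = 1 ∨ B i a b = -1)
    (weight : ∀ i, B i * (B i)ᵀ = (w i : ℝ) • 1)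
    (amicable : ∀ i j, c i ≠ c j → B i * (B j)ᵀ = B j * (B i)ᵀ)
    (disjoint : ∀ i j, i ≠ j → c i = c j → ∀ a b, B i a b * B j a b = 0)
    (antiamicable : ∀ i j, i ≠ j → c i = c j → B i * (B j)ᵀ + B j * (B i)ᵀ = 0) :
    IsOD (fun i => u (c i) * w i)
      (fun i => reindex finProdFinEquiv finProdFinEquiv (A (c i) ⊗ₖ B i)) := by
  obtain ⟨hent, hdis, hwt, hanti⟩ := h
  have hmul : ∀ i j, reindex finProdFinEquiv finProdFinEquiv (A (c i) ⊗ₖ B i) *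
      (reindex finProdFinEquiv finProdFinEquiv (A (c j) ⊗ₖ B j))ᵀ =
      reindex finProdFinEquiv finProdFinEquiv ((A (c i) * (A (c j))ᵀ) ⊗ₖ (B i * (B j)ᵀ)) := by
    intro i j
    rw [mul_kronecker_mul, kroneckerMap_transpose]
    simp only [reindex_apply, transpose_submatrix, submatrix_mul_equiv]
  refine ⟨fun i a b => ?_, fun i j hij a b => ?_, fun i => ?_, fun i j hij => ?_⟩
  · simp only [reindex_apply, submatrix_apply, kroneckerMap_apply]
    rcases hent (c i) (finProdFinEquiv.symm a).1 (finProdFinEquiv.symm b).1 with h | h | h <;>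
    rcases entries i (finProdFinEquiv.symm a).2 (finProdFinEquiv.symm b).2 with h' | h' | h' <;>
    rw [h, h'] <;> norm_num
  · simp only [reindex_apply, submatrix_apply, kroneckerMap_apply]
    rw [mul_mul_mul_comm]
    by_cases hc : c i = c j
    · rw [disjoint i j hij hc, mul_zero]
    · rw [hdis _ _ hc, zero_mul]
  · rw [hmul, hwt, weight, smul_kronecker, kronecker_smul, one_kronecker_one, smul_smul]
    simp [submatrix_smul]
  · rw [hmul, hmul]
    simp only [reindex_apply]
    rw [← Pi.add_apply, ← Pi.add_apply, ← submatrix_add]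
    by_cases hc : c i = c j
    · rw [hc, ← kronecker_add, antiamicable i j hij hc]
      simp
    · rw [amicable i j hc, ← add_kronecker, hanti _ _ hc]
      simp

/-- Doubling the order splits one variable into two of the same weight and doubles the weights of
the other variables. -/
theorem split (h : IsOD u A) (s : Fin k) :
    ∃ B : Fin (k + 1) → Matrix (Fin (n * 2)) (Fin (n * 2)) ℝ,
      IsOD (fun i => u ((Fin.cons s id : Fin (k + 1) → Fin k) i) *
        (Fin.cons 1 (fun j => if j = s then 1 else 2) : Fin (k + 1) → ℕ) i) B := by
  refine ⟨_, h.kronecker (Fin.cons s id) (Fin.cons 1 fun j => if j = s then 1 else 2)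
    (Fin.cons !![0, 1; -1, 0] fun j => if j = s then 1 else !![1, 1; 1, -1]) ?_ ?_ ?_ ?_ ?_⟩
  · refine Fin.cases ?_ fun i => ?_
    · intro a b
      fin_cases a <;> fin_cases b <;> simp
    · intro a b
      by_cases hi : i = s <;> fin_cases a <;> fin_cases b <;> simp [hi]
  · refine Fin.cases ?_ fun i => ?_
    · ext a b
      fin_cases a <;> fin_cases b <;> simp [Matrix.mul_apply]
    · by_cases hi : i = s
      · simp [hi]
      · ext a b
        fin_cases a <;> fin_cases b <;> simp [hi, Matrix.mul_apply] <;> norm_num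
  · refine Fin.cases (Fin.cases ?_ fun j => ?_) fun i => Fin.cases ?_ fun j => ?_
    · simp
    · intro hj
      have hj : j ≠ s := fun e => hj (by simp [e])
      ext a b
      fin_cases a <;> fin_cases b <;> simp [hj, Matrix.mul_apply]
    · intro hi
      have hi : i ≠ s := fun e => hi (by simp [e])
      ext a b
      fin_cases a <;> fin_cases b <;> simp [hi, Matrix.mul_apply]
    · intro _
      by_cases hi : i = s <;> by_cases hj : j = s <;> ext a b <;>
        fin_cases a <;> fin_cases b <;> simp [hi, hj, Matrix.mul_apply]
  · refine Fin.cases (Fin.cases ?_ fun j => ?_) fun i => Fin.cases ?_ fun j => ?_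
    · simp
    · intro _ hj a b
      have hj : s = j := by simpa using hj
      fin_cases a <;> fin_cases b <;> simp [hj]
    · intro _ hi a b
      have hi : i = s := by simpa using hi
      fin_cases a <;> fin_cases b <;> simp [hi]
    · intro hij hc
      exact absurd (by simpa using hc) hij
  · refine Fin.cases (Fin.cases ?_ fun j => ?_) fun i => Fin.cases ?_ fun j => ?_
    · simp
    · intro _ hj
      have hj : s = j := by simpa using hj
      ext a b
      fin_cases a <;> fin_cases b <;> simp [hj]
    · intro _ hi
      have hi : i = s := by simpa using hi
      ext a b
      fin_cases a <;> fin_cases b <;> simp [hi]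
    · intro hij hc
      exact absurd (by simpa using hc) hij

/-- Equating variables of an orthogonal design adds their weights. -/
theorem merge (h : IsOD u A) {l : ℕ} (f : Fin k → Fin l) {v : Fin l → ℕ}
    (hv : ∀ j, v j = ∑ i with f i = j, u i) :
    IsOD v (fun j => ∑ i with f i = j, A i) := by
  obtain ⟨hent, hdis, hwt, hanti⟩ := h
  have hne : ∀ {j j' : Fin l}, j ≠ j' → ∀ x ∈ Finset.univ.filter (f · = j),
      ∀ y ∈ Finset.univ.filter (f · = j'), x ≠ y := by
    intro j j' hj x hx y hy hxy
    simp only [Finset.mem_filter, Finset.mem_univ, true_and] at hx hy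
    exact hj (by rw [← hx, ← hy, hxy])
  refine ⟨fun j a b => ?_, fun j j' hj a b => ?_, fun j => ?_, fun j j' hj => ?_⟩
  · simp only [Matrix.sum_apply]
    by_cases hz : ∃ i ∈ Finset.univ.filter (f · = j), A i a b ≠ 0
    · obtain ⟨i, hi, hi0⟩ := hz
      rw [Finset.sum_eq_single_of_mem i hi fun i' _ hne' =>
        (mul_eq_zero.mp (hdis i' i hne' a b)).resolve_right hi0]
      exact hent i a b
    · push Not at hz
      exact Or.inl (Finset.sum_eq_zero hz)
  · simp only [Matrix.sum_apply, Finset.sum_mul_sum]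
    exact Finset.sum_eq_zero fun x hx => Finset.sum_eq_zero fun y hy =>
      hdis x y (hne hj x hx y hy) a b
  · rw [transpose_sum, Finset.sum_mul_sum]
    refine smul_right_injective _ (two_ne_zero (α := ℝ)) ?_
    simp only [two_smul]
    nth_rewrite 2 [Finset.sum_comm]
    simp only [← Finset.sum_add_distrib]
    have hterm : ∀ x ∈ Finset.univ.filter (f · = j),
        ∑ y with f y = j, (A x * (A y)ᵀ + A y * (A x)ᵀ) = (u x : ℝ) • 1 + (u x : ℝ) • 1 := by
      intro x hx
      rw [Finset.sum_eq_single_of_mem x hx fun y _ hyx => hanti x y hyx.symm, hwt]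
    rw [Finset.sum_congr rfl hterm, Finset.sum_add_distrib, ← Finset.sum_smul, hv,
      Nat.cast_sum]
  · simp only [transpose_sum, Finset.sum_mul_sum]
    nth_rewrite 2 [Finset.sum_comm]
    simp only [← Finset.sum_add_distrib]
    exact Finset.sum_eq_zero fun x hx => Finset.sum_eq_zero fun y hy =>
      hanti x y (hne hj x hx y hy)

end IsOD

/-- The trivial orthogonal design of order one. -/
theorem isOD_one : IsOD (![1] : Fin 1 → ℕ) (fun _ => (1 : Matrix (Fin 1) (Fin 1) ℝ)) := by
  refine ⟨fun i a b => ?_, fun i j hij => ?_, fun i => ?_, fun i j hij => ?_⟩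
  · exact Or.inr (Or.inl (Subsingleton.elim a b ▸ one_apply_eq a))
  · exact absurd (Subsingleton.elim i j) hij
  · simp [Subsingleton.elim i 0]
  · exact absurd (Subsingleton.elim i j) hij

/-- There exists an `OD(2^12; 2^7·1, 2^7·1, 2^7·1, 2^7·9, 2^7·9, 2^7·11)`. -/
theorem exists_OD_2pow12_type :
    ∃ A : Fin 6 → Matrix (Fin (2 ^ 12)) (Fin (2 ^ 12)) ℝ,
      IsOD ![2 ^ 7 * 1, 2 ^ 7 * 1, 2 ^ 7 * 1, 2 ^ 7 * 9, 2 ^ 7 * 9, 2 ^ 7 * 11] A := by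
  obtain ⟨_, h⟩ := isOD_one.split 0
  obtain ⟨_, h⟩ := h.split 0
  obtain ⟨_, h⟩ := h.split 2
  obtain ⟨_, h⟩ := h.split 0
  obtain ⟨_, h⟩ := h.split 0
  obtain ⟨_, h⟩ := h.split 2
  obtain ⟨_, h⟩ := h.split 0
  obtain ⟨_, h⟩ := h.split 2
  obtain ⟨_, h⟩ := h.split 4
  obtain ⟨_, h⟩ := h.split 0
  obtain ⟨_, h⟩ := h.split 2
  obtain ⟨A, h⟩ := h.split 4
  -- The weights are now `64` (six times), `128` (three times), `256` and `1024` (three times).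
  exact ⟨_, h.merge ![0, 0, 1, 1, 2, 2, 3, 4, 5, 5, 3, 4, 5] (by decide)⟩
end

section
/- Let N, m, p be positive integers. Suppose A_0, …, A_{N−1} are real m×m matrices with A_i * A_iᵀ = 1 for every i and A_i * A_jᵀ = −(A_j * A_iᵀ) for all i ≠ j (pairwise anti-amicable), and B_0, …, B_{N−1} are real p×p matrices with entries in {0, 1}, pairwise disjoint (for every position and i ≠ j, the entries of B_i and B_j cannot both be nonzero), satisfying B_i * B_iᵀ = 1 for every i and B_i * B_jᵀ = B_j * B_iᵀ for all i ≠ j (pairwise amicable). Then the Kronecker products C_i = B_i ⊗ A_i are pairwise disjoint and satisfy C_i * C_iᵀ = 1 for every i and C_i * C_jᵀ + C_j * C_iᵀ = 0 for all i ≠ j; consequently, for all real x_0, …, x_{N−1}, the matrix X = Σ_i x_i · C_i satisfies X * Xᵀ = (Σ_i x_i²) • 1 on Matrix (Fin (p·m)) (Fin (p·m)) ℝ. -/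
open Matrix Kronecker

/-- A real linear combination of matrices with `C i * (C i)ᵀ = 1` that are pairwise anti-amicable
satisfies `X * Xᵀ = (∑ i, (x i)²) • 1`. -/
theorem sum_smul_mul_transpose_of_antiAmicable {ι n : Type*} [Fintype ι] [Fintype n]
    [DecidableEq n] (C : ι → Matrix n n ℝ) (hC : ∀ i, C i * (C i)ᵀ = 1)
    (hanti : ∀ i j, i ≠ j → C i * (C j)ᵀ + C j * (C i)ᵀ = 0) (x : ι → ℝ) :
    (∑ i, x i • C i) * (∑ i, x i • C i)ᵀ = (∑ i, x i ^ 2) • 1 := by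
  have expand : (∑ i, x i • C i) * (∑ i, x i • C i)ᵀ =
      ∑ i, ∑ j, (x i * x j) • (C i * (C j)ᵀ) := by
    simp only [transpose_sum, transpose_smul, Finset.sum_mul_sum, smul_mul_smul_comm]
  have double : (2 : ℝ) • ∑ i, ∑ j, (x i * x j) • (C i * (C j)ᵀ) =
      (2 : ℝ) • (∑ i, x i ^ 2) • (1 : Matrix n n ℝ) := by
    calc (2 : ℝ) • ∑ i, ∑ j, (x i * x j) • (C i * (C j)ᵀ)
        = ∑ i, ∑ j, (x i * x j) • (C i * (C j)ᵀ + C j * (C i)ᵀ) := by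
          rw [two_smul]
          nth_rewrite 2 [Finset.sum_comm]
          simp only [← Finset.sum_add_distrib, smul_add]
          exact Fintype.sum_congr _ _ fun i => Fintype.sum_congr _ _ fun j => by
            rw [mul_comm (x j)]
      _ = ∑ i, (x i * x i) • (C i * (C i)ᵀ + C i * (C i)ᵀ) :=
          Finset.sum_congr rfl fun i _ => Fintype.sum_eq_single i fun j hj => by
            rw [hanti i j hj.symm, smul_zero]
      _ = (2 : ℝ) • (∑ i, x i ^ 2) • (1 : Matrix n n ℝ) := by
          simp only [hC, ← two_smul ℝ (1 : Matrix n n ℝ), ← Finset.sum_smul, ← pow_two]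
          rw [smul_comm]
  rw [expand]
  exact smul_right_injective _ (two_ne_zero' ℝ) double

/-- If `A 0, …, A (N-1)` are pairwise anti-amicable real orthogonal-type
matrices of order `m` and `B 0, …, B (N-1)` are pairwise disjoint, pairwise
amicable `{0,1}`-matrices of order `p` with `B i * (B i)ᵀ = 1`, then the
Kronecker products `C i = B i ⊗ₖ A i` are pairwise disjoint, satisfy
`C i * (C i)ᵀ = 1` and `C i * (C j)ᵀ + C j * (C i)ᵀ = 0` for `i ≠ j`, and
`X = ∑ i, x i • C i` satisfies `X * Xᵀ = (∑ i, (x i)²) • 1`. -/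
theorem kronecker_anti_amicable_amicable (N m p : ℕ) (hN : 0 < N) (hm : 0 < m) (hp : 0 < p)
    (A : Fin N → Matrix (Fin m) (Fin m) ℝ) (B : Fin N → Matrix (Fin p) (Fin p) ℝ)
    (hA1 : ∀ i : Fin N, A i * (A i)ᵀ = 1)
    (hA2 : ∀ i j : Fin N, i ≠ j → A i * (A j)ᵀ = -(A j * (A i)ᵀ))
    (hB0 : ∀ (i : Fin N) (a b : Fin p), B i a b = 0 ∨ B i a b = 1)
    (hBdisj : ∀ i j : Fin N, i ≠ j → ∀ a b : Fin p, B i a b * B j a b = 0)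
    (hB1 : ∀ i : Fin N, B i * (B i)ᵀ = 1)
    (hB2 : ∀ i j : Fin N, i ≠ j → B i * (B j)ᵀ = B j * (B i)ᵀ) :
    (∀ i j : Fin N, i ≠ j → ∀ a b : Fin p × Fin m,
      (B i ⊗ₖ A i) a b * (B j ⊗ₖ A j) a b = 0) ∧
    (∀ i : Fin N, (B i ⊗ₖ A i) * (B i ⊗ₖ A i)ᵀ = 1) ∧
    (∀ i j : Fin N, i ≠ j →
      (B i ⊗ₖ A i) * (B j ⊗ₖ A j)ᵀ + (B j ⊗ₖ A j) * (B i ⊗ₖ A i)ᵀ = 0) ∧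
    ∀ x : Fin N → ℝ,
      (∑ i : Fin N, x i • (B i ⊗ₖ A i)) * (∑ i : Fin N, x i • (B i ⊗ₖ A i))ᵀ =
        (∑ i : Fin N, (x i) ^ 2) • 1 := by
  have kron_mul (i j : Fin N) : (B i ⊗ₖ A i) * (B j ⊗ₖ A j)ᵀ =
      (B i * (B j)ᵀ) ⊗ₖ (A i * (A j)ᵀ) := by
    rw [← kroneckerMap_transpose, ← mul_kronecker_mul]
  have orthogonal (i : Fin N) : (B i ⊗ₖ A i) * (B i ⊗ₖ A i)ᵀ = 1 := by
    rw [kron_mul, hB1, hA1, one_kronecker_one]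
  have anti (i j : Fin N) (hij : i ≠ j) :
      (B i ⊗ₖ A i) * (B j ⊗ₖ A j)ᵀ + (B j ⊗ₖ A j) * (B i ⊗ₖ A i)ᵀ = 0 := by
    rw [kron_mul, kron_mul, hB2 i j hij, ← kronecker_add, hA2 i j hij, neg_add_cancel,
      kronecker_zero]
  refine ⟨fun i j hij a b => ?_, orthogonal, anti,
    sum_smul_mul_transpose_of_antiAmicable _ orthogonal anti⟩
  rw [kronecker_apply, kronecker_apply, mul_mul_mul_comm, hBdisj i j hij, zero_mul]
end
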